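/- Let n ≥ 1, −n < a < +∞, 1 ≤ p < +∞ and C_n > 0. Suppose u ∈ C(cl(ℝⁿ₊)) is a nonnegative solution of u(x) = ∫_{ℝⁿ₊} G⁺(x,y) |y|^a u(y)^p dy on ℝⁿ₊ which is not identically zero. Then for every λ > 0 and every x ∈ ℝⁿ₊ with |x| ≥ λ one has u(x) ≥ u(λ² x/|x|²); in particular, for every x ∈ ℝⁿ₊ with |x| ≥ 1, u(x) ≥ u(x/|x|), so u is bounded below on {x ∈ ℝⁿ₊ : |x| ≥ 1, xₙ ≥ |x|/√n} by the positive constant min{u(z) : |z| = 1, zₙ ≥ 1/√n}. -/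

import Mathlib

open MeasureTheory Real Set Metric

noncomputable section

abbrev E (n : ℕ) := EuclideanSpace ℝ (Fin n)

/-- The last coordinate `xₙ` of a point `x ∈ ℝⁿ` (junk value `0` when `n = 0`). -/
def lastCoord (n : ℕ) (x : E n) : ℝ :=
  if h : 0 < n then x ⟨n - 1, Nat.sub_lt h Nat.one_pos⟩ else 0

/-- The upper half space `ℝⁿ₊ = {x : xₙ > 0}`. -/
def halfSpace (n : ℕ) : Set (E n) := {x | 0 < lastCoord n x}

/-- The last standard basis vector `eₙ`. -/
def lastBasis (n : ℕ) : E n :=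
  if h : 0 < n then EuclideanSpace.single ⟨n - 1, Nat.sub_lt h Nat.one_pos⟩ (1 : ℝ) else 0

/-- The reflection `x̄ = (x₁, …, x_{n−1}, −xₙ)` of `x` across `∂ℝⁿ₊`. -/
def reflect (n : ℕ) (x : E n) : E n := x - (2 * lastCoord n x) • lastBasis n

/-- The kernel `G⁺(x,y) = C_n (ln(1/|x−y|) − ln(1/|x̄−y|))`, the Green function of
`(−Δ)^{n/2}` on the half space with Navier boundary conditions. -/
def Gplus (n : ℕ) (Cn : ℝ) (x y : E n) : ℝ :=
  Cn * (Real.log (1 / ‖x - y‖) - Real.log (1 / ‖reflect n x - y‖))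

/-- The Laplacian `Δu = ∑ᵢ ∂²u/∂xᵢ²`. -/
def lap (n : ℕ) (u : E n → ℝ) (x : E n) : ℝ :=
  ∑ i, fderiv ℝ (fun y => fderiv ℝ u y (EuclideanSpace.single i 1)) x
    (EuclideanSpace.single i 1)

/-- The iterate `(−Δ)^k u` of the negative Laplacian. -/
def negLapIter (n k : ℕ) (u : E n → ℝ) : E n → ℝ :=
  (fun v x => - lap n v x)^[k] u

open EuclideanGeometry Filter Topology

section HalfSpace

variable {n : ℕ}

lemma lastCoord_smul (c : ℝ) (x : E n) : lastCoord n (c • x) = c * lastCoord n x := by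
  unfold lastCoord
  split_ifs <;> simp

lemma continuous_lastCoord : Continuous (lastCoord n) := by
  unfold lastCoord
  split_ifs <;> fun_prop

lemma isOpen_halfSpace : IsOpen (halfSpace n) :=
  isOpen_lt continuous_const continuous_lastCoord

lemma measurableSet_halfSpace : MeasurableSet (halfSpace n) :=
  isOpen_halfSpace.measurableSet

lemma ne_zero_of_mem_halfSpace {x : E n} (hx : x ∈ halfSpace n) : x ≠ 0 := by
  rintro rfl
  have h := lastCoord_smul 0 (0 : E n)
  simp only [zero_smul, zero_mul] at h
  exact hx.ne' h

lemma norm_pos_of_mem_halfSpace {x : E n} (hx : x ∈ halfSpace n) : 0 < ‖x‖ :=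
  norm_pos_iff.2 (ne_zero_of_mem_halfSpace hx)

lemma lastCoord_le_norm (x : E n) : lastCoord n x ≤ ‖x‖ := by
  unfold lastCoord
  split_ifs
  · exact (le_abs_self _).trans (PiLp.norm_apply_le x _)
  · exact norm_nonneg x

lemma smul_mem_halfSpace {c : ℝ} (hc : 0 < c) {x : E n} (hx : x ∈ halfSpace n) :
    c • x ∈ halfSpace n := by
  have hx' : 0 < lastCoord n x := hx
  change 0 < lastCoord n (c • x)
  rw [lastCoord_smul]
  positivity

lemma norm_reflect_sub_sq (hn : 1 ≤ n) (x y : E n) :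
    ‖reflect n x - y‖ ^ 2 = ‖x - y‖ ^ 2 + 4 * lastCoord n x * lastCoord n y := by
  have hn' : 0 < n := hn
  have h : reflect n x - y = (x - y) - (2 * lastCoord n x) • lastBasis n := by
    unfold reflect; abel
  have h1 : ‖lastBasis n‖ = 1 := by simp [lastBasis, hn']
  have h2 : inner ℝ (x - y) (lastBasis n) = lastCoord n x - lastCoord n y := by
    simp [lastBasis, lastCoord, hn', EuclideanSpace.inner_single_right]
  rw [h, norm_sub_sq_real, norm_smul, inner_smul_right, h1, h2, mul_one, Real.norm_eq_abs, sq_abs]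
  ring

/-- The Green function written as `C / 2 * log (1 + 4 xₙ yₙ / |x - y|²)`. -/
def halfSpaceKernel (n : ℕ) (C : ℝ) (x y : E n) : ℝ :=
  C / 2 * Real.log (1 + 4 * lastCoord n x * lastCoord n y / ‖x - y‖ ^ 2)

lemma Gplus_eq_halfSpaceKernel (hn : 1 ≤ n) (C : ℝ) {x y : E n} (hx : x ∈ halfSpace n)
    (hy : y ∈ halfSpace n) (hxy : y ≠ x) : Gplus n C x y = halfSpaceKernel n C x y := by
  have hd : 0 < ‖x - y‖ := norm_pos_iff.2 (sub_ne_zero.2 hxy.symm)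
  have hx' : 0 < lastCoord n x := hx
  have hy' : 0 < lastCoord n y := hy
  have h := norm_reflect_sub_sq hn x y
  have hr : 0 < ‖reflect n x - y‖ := by
    refine (norm_nonneg _).lt_of_ne fun h0 => ?_
    rw [← h0] at h
    have : 0 < ‖x - y‖ ^ 2 + 4 * lastCoord n x * lastCoord n y := by positivity
    linarith
  have h3 : 1 + 4 * lastCoord n x * lastCoord n y / ‖x - y‖ ^ 2
      = ‖reflect n x - y‖ ^ 2 / ‖x - y‖ ^ 2 := by
    rw [h]; field_simp
  rw [Gplus, halfSpaceKernel, h3, one_div, one_div, Real.log_inv, Real.log_inv,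
    Real.log_div (by positivity) (by positivity), Real.log_pow, Real.log_pow]
  push_cast
  ring

lemma halfSpaceKernel_arg_nonneg {x y : E n} (hx : x ∈ halfSpace n) (hy : y ∈ halfSpace n) :
    0 ≤ 4 * lastCoord n x * lastCoord n y / ‖x - y‖ ^ 2 := by
  have hx' : 0 < lastCoord n x := hx
  have hy' : 0 < lastCoord n y := hy
  positivity

lemma halfSpaceKernel_nonneg {C : ℝ} (hC : 0 ≤ C) {x y : E n} (hx : x ∈ halfSpace n)
    (hy : y ∈ halfSpace n) : 0 ≤ halfSpaceKernel n C x y := by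
  have := halfSpaceKernel_arg_nonneg hx hy
  exact mul_nonneg (by positivity) (Real.log_nonneg (by linarith))

lemma halfSpaceKernel_pos {C : ℝ} (hC : 0 < C) {x y : E n} (hx : x ∈ halfSpace n)
    (hy : y ∈ halfSpace n) (hxy : y ≠ x) : 0 < halfSpaceKernel n C x y := by
  have hd : 0 < ‖x - y‖ := norm_pos_iff.2 (sub_ne_zero.2 hxy.symm)
  have hx' : 0 < lastCoord n x := hx
  have hy' : 0 < lastCoord n y := hy
  refine mul_pos (by positivity) (Real.log_pos ?_)
  have : 0 < 4 * lastCoord n x * lastCoord n y / ‖x - y‖ ^ 2 := by positivity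
  linarith

lemma measurable_halfSpaceKernel (C : ℝ) (x : E n) : Measurable (halfSpaceKernel n C x) := by
  have h : Measurable (lastCoord n) := continuous_lastCoord.measurable
  unfold halfSpaceKernel
  fun_prop

end HalfSpace

section Inversion

variable {n : ℕ}

lemma inversion_zero_eq (L : ℝ) (x : E n) :
    inversion (0 : E n) L x = (L ^ 2 / ‖x‖ ^ 2) • x := by
  simp [inversion, div_pow]

lemma norm_inversion_zero (L : ℝ) (x : E n) : ‖inversion (0 : E n) L x‖ = L ^ 2 / ‖x‖ := by
  simpa using dist_inversion_center (0 : E n) x L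

lemma lastCoord_inversion (L : ℝ) (x : E n) :
    lastCoord n (inversion (0 : E n) L x) = L ^ 2 / ‖x‖ ^ 2 * lastCoord n x := by
  rw [inversion_zero_eq, lastCoord_smul]

lemma inversion_mem_halfSpace {L : ℝ} (hL : 0 < L) {x : E n} (hx : x ∈ halfSpace n) :
    inversion (0 : E n) L x ∈ halfSpace n := by
  have := norm_pos_of_mem_halfSpace hx
  rw [inversion_zero_eq]
  exact smul_mem_halfSpace (by positivity) hx

lemma norm_inversion_lt {L : ℝ} (hL : 0 < L) {x : E n} (hx : L < ‖x‖) :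
    ‖inversion (0 : E n) L x‖ < L := by
  rw [norm_inversion_zero, div_lt_iff₀ (hL.trans hx)]
  nlinarith

lemma lt_norm_inversion {L : ℝ} {x : E n} (h0 : 0 < ‖x‖) (hx : ‖x‖ < L) :
    L < ‖inversion (0 : E n) L x‖ := by
  rw [norm_inversion_zero, lt_div_iff₀ h0]
  nlinarith

lemma halfSpaceKernel_inversion_inversion (C : ℝ) {L : ℝ} (hL : 0 < L) {x y : E n}
    (hx : x ∈ halfSpace n) (hy : y ∈ halfSpace n) :
    halfSpaceKernel n C (inversion (0 : E n) L x) (inversion (0 : E n) L y)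
      = halfSpaceKernel n C x y := by
  have hx0 := norm_pos_of_mem_halfSpace hx
  have hy0 := norm_pos_of_mem_halfSpace hy
  have h := dist_inversion_inversion (norm_pos_iff.1 hx0) (norm_pos_iff.1 hy0) L
  simp only [dist_eq_norm, sub_zero] at h
  unfold halfSpaceKernel
  rw [h, lastCoord_inversion, lastCoord_inversion]
  rcases eq_or_ne (‖x - y‖) 0 with h0 | h0
  · simp [h0]
  · congr 3
    field_simp

lemma halfSpaceKernel_inversion_left (C : ℝ) {L : ℝ} (hL : 0 < L) {x y : E n}
    (hx : x ∈ halfSpace n) (hy : y ∈ halfSpace n) :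
    halfSpaceKernel n C (inversion (0 : E n) L x) y
      = halfSpaceKernel n C x (inversion (0 : E n) L y) := by
  rw [← halfSpaceKernel_inversion_inversion C hL hx (inversion_mem_halfSpace hL hy),
    inversion_inversion _ hL.ne']

lemma halfSpaceKernel_inversion_lt {C : ℝ} (hC : 0 < C) {L : ℝ} {x y : E n}
    (hx : x ∈ halfSpace n) (hy : y ∈ halfSpace n) (hxL : ‖x‖ < L) (hyL : ‖y‖ < L)
    (hxy : y ≠ x) :
    halfSpaceKernel n C x (inversion (0 : E n) L y) < halfSpaceKernel n C x y := by
  have hx0 := norm_pos_of_mem_halfSpace hx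
  have hy0 := norm_pos_of_mem_halfSpace hy
  have hL : 0 < L := hx0.trans hxL
  have hx' : 0 < lastCoord n x := hx
  have hy' : 0 < lastCoord n y := hy
  have hd : 0 < ‖x - y‖ := norm_pos_iff.2 (sub_ne_zero.2 hxy.symm)
  have key : ‖y‖ ^ 2 * ‖x - inversion (0 : E n) L y‖ ^ 2
      = L ^ 2 * ‖x - y‖ ^ 2 + (L ^ 2 - ‖x‖ ^ 2) * (L ^ 2 - ‖y‖ ^ 2) := by
    rw [inversion_zero_eq, norm_sub_sq_real, norm_sub_sq_real, norm_smul, inner_smul_right,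
      Real.norm_eq_abs, mul_pow, sq_abs]
    field_simp
    ring
  have hpos : 0 < (L ^ 2 - ‖x‖ ^ 2) * (L ^ 2 - ‖y‖ ^ 2) :=
    mul_pos (by nlinarith) (by nlinarith)
  have hD : 0 < ‖x - inversion (0 : E n) L y‖ ^ 2 := by
    have : 0 < ‖y‖ ^ 2 * ‖x - inversion (0 : E n) L y‖ ^ 2 := by
      rw [key]; positivity
    exact pos_of_mul_pos_right this (by positivity)
  unfold halfSpaceKernel
  refine mul_lt_mul_of_pos_left (Real.log_lt_log ?_ ?_) (by positivity)
  · have := halfSpaceKernel_arg_nonneg hx (inversion_mem_halfSpace hL hy)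
    linarith
  · rw [add_lt_add_iff_left, lastCoord_inversion, div_lt_div_iff₀ hD (by positivity)]
    have h1 : 0 < 4 * lastCoord n x * lastCoord n y / ‖y‖ ^ 2 := by positivity
    calc 4 * lastCoord n x * (L ^ 2 / ‖y‖ ^ 2 * lastCoord n y) * ‖x - y‖ ^ 2
        = 4 * lastCoord n x * lastCoord n y / ‖y‖ ^ 2 * (L ^ 2 * ‖x - y‖ ^ 2) := by ring
      _ < 4 * lastCoord n x * lastCoord n y / ‖y‖ ^ 2
          * (‖y‖ ^ 2 * ‖x - inversion (0 : E n) L y‖ ^ 2) := by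
        rw [key]; exact mul_lt_mul_of_pos_left (by linarith) h1
      _ = 4 * lastCoord n x * lastCoord n y * ‖x - inversion (0 : E n) L y‖ ^ 2 := by
        field_simp

lemma halfSpaceKernel_inversion_le {C : ℝ} (hC : 0 < C) {L : ℝ} {x y : E n}
    (hx : x ∈ halfSpace n) (hy : y ∈ halfSpace n) (hxL : ‖x‖ < L) (hyL : ‖y‖ < L)
    (hxy : y ≠ x) :
    halfSpaceKernel n C x (inversion (0 : E n) L y) ≤ halfSpaceKernel n C x y :=
  (halfSpaceKernel_inversion_lt hC hx hy hxL hyL hxy).le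

lemma image_inversion_halfSpace_inter_ball {L : ℝ} (hL : 0 < L) :
    inversion (0 : E n) L '' (halfSpace n ∩ ball 0 L) = halfSpace n ∩ {y | L < ‖y‖} := by
  ext y
  constructor
  · rintro ⟨x, ⟨hx, hxL⟩, rfl⟩
    exact ⟨inversion_mem_halfSpace hL hx,
      lt_norm_inversion (norm_pos_of_mem_halfSpace hx) (mem_ball_zero_iff.1 hxL)⟩
  · rintro ⟨hy, hyL⟩
    exact ⟨inversion (0 : E n) L y, ⟨inversion_mem_halfSpace hL hy,
      mem_ball_zero_iff.2 (norm_inversion_lt hL hyL)⟩, inversion_inversion _ hL.ne' y⟩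

lemma abs_det_fderiv_inversion (L : ℝ) (x : E n) :
    |((L / dist x (0 : E n)) ^ 2 •
      ((Submodule.span ℝ {x - 0})ᗮ.reflection : E n →L[ℝ] E n)).det| = (L / ‖x‖) ^ (2 * n) := by
  rw [ContinuousLinearMap.det, ContinuousLinearMap.toLinearMap_smul, LinearMap.det_smul, abs_mul]
  have h : |LinearMap.det ((((Submodule.span ℝ {x - 0})ᗮ.reflection : E n →L[ℝ] E n)) :
      E n →ₗ[ℝ] E n)| = 1 := by
    have := Submodule.det_reflection (𝕜 := ℝ) ((Submodule.span ℝ {x - 0})ᗮ)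
    erw [this]
    simp
  rw [h, finrank_euclideanSpace_fin, ← pow_mul, dist_zero_right, mul_one, abs_of_nonneg]
  exact (even_two_mul n).pow_nonneg _

/-- Change of variables `y ↦ L² y / |y|²` between the inside and the outside of a half ball. -/
lemma setIntegral_outside_halfBall {L : ℝ} (hL : 0 < L) (g : E n → ℝ) :
    ∫ y in halfSpace n ∩ {y | L < ‖y‖}, g y
      = ∫ y in halfSpace n ∩ ball 0 L, (L / ‖y‖) ^ (2 * n) * g (inversion (0 : E n) L y) := by
  rw [← image_inversion_halfSpace_inter_ball hL,
    integral_image_eq_integral_abs_det_fderiv_smul volume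
      (measurableSet_halfSpace.inter measurableSet_ball)
      (fun x hx => (hasFDerivAt_inversion (c := (0 : E n)) (R := L)
        (ne_zero_of_mem_halfSpace hx.1)).hasFDerivWithinAt)
      (inversion_injective _ hL.ne').injOn]
  simp only [abs_det_fderiv_inversion, smul_eq_mul]

lemma integrableOn_outside_halfBall_iff {L : ℝ} (hL : 0 < L) (g : E n → ℝ) :
    IntegrableOn g (halfSpace n ∩ {y | L < ‖y‖})
      ↔ IntegrableOn (fun y => (L / ‖y‖) ^ (2 * n) * g (inversion (0 : E n) L y))
        (halfSpace n ∩ ball 0 L) := by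
  rw [← image_inversion_halfSpace_inter_ball hL,
    integrableOn_image_iff_integrableOn_abs_det_fderiv_smul volume
      (measurableSet_halfSpace.inter measurableSet_ball)
      (fun x hx => (hasFDerivAt_inversion (c := (0 : E n)) (R := L)
        (ne_zero_of_mem_halfSpace hx.1)).hasFDerivWithinAt)
      (inversion_injective _ hL.ne').injOn]
  simp only [abs_det_fderiv_inversion, smul_eq_mul]

end Inversion

section KernelEstimates

variable {n : ℕ}

lemma halfSpaceKernel_le_rpow {C Λ η : ℝ} (hC : 0 < C) (hη : 0 < η) {x y : E n}
    (hx : x ∈ halfSpace n) (hy : y ∈ halfSpace n) (hxΛ : ‖x‖ < Λ) (hyΛ : ‖y‖ < Λ)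
    (hxy : y ≠ x) :
    halfSpaceKernel n C x y ≤ C / 2 * ((8 * Λ ^ 2) ^ η / η) * ‖x - y‖ ^ (-(2 * η)) := by
  have hd : 0 < ‖x - y‖ := norm_pos_iff.2 (sub_ne_zero.2 hxy.symm)
  have hx' : 0 < lastCoord n x := hx
  have hy' : 0 < lastCoord n y := hy
  have hx0 := norm_pos_of_mem_halfSpace hx
  have hΛ : 0 < Λ := hx0.trans hxΛ
  have h1 : 1 + 4 * lastCoord n x * lastCoord n y / ‖x - y‖ ^ 2 ≤ 8 * Λ ^ 2 / ‖x - y‖ ^ 2 := by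
    have e : 1 + 4 * lastCoord n x * lastCoord n y / ‖x - y‖ ^ 2
        = (‖x - y‖ ^ 2 + 4 * lastCoord n x * lastCoord n y) / ‖x - y‖ ^ 2 := by field_simp
    rw [e]
    gcongr
    have h2 : ‖x - y‖ ≤ 2 * Λ := (norm_sub_le x y).trans (by linarith)
    have h3 : lastCoord n x ≤ Λ := (lastCoord_le_norm x).trans hxΛ.le
    have h4 : lastCoord n y ≤ Λ := (lastCoord_le_norm y).trans hyΛ.le
    have h5 : ‖x - y‖ ^ 2 ≤ (2 * Λ) ^ 2 := by gcongr
    have h6 : lastCoord n x * lastCoord n y ≤ Λ * Λ := by gcongr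
    nlinarith
  have h0 := halfSpaceKernel_arg_nonneg hx hy
  have h7 : (8 * Λ ^ 2 / ‖x - y‖ ^ 2) ^ η = (8 * Λ ^ 2) ^ η * ‖x - y‖ ^ (-(2 * η)) := by
    rw [Real.div_rpow (by positivity) (by positivity), Real.rpow_neg hd.le, Real.rpow_mul hd.le,
      Real.rpow_two, div_eq_mul_inv]
  calc halfSpaceKernel n C x y
      ≤ C / 2 * ((8 * Λ ^ 2 / ‖x - y‖ ^ 2) ^ η / η) := by
        unfold halfSpaceKernel
        gcongr
        exact (Real.log_le_log (by linarith) h1).trans (Real.log_le_rpow_div (by positivity) hη)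
    _ = _ := by rw [h7]; ring

lemma rpow_mul_rpow_le_add {s t α β : ℝ} (hs : 0 < s) (ht : 0 < t) (hα : α ≤ 0) (hβ : β ≤ 0) :
    s ^ α * t ^ β ≤ s ^ (α + β) + t ^ (α + β) := by
  rcases le_total s t with h | h
  · have h1 : t ^ β ≤ s ^ β := Real.rpow_le_rpow_of_nonpos hs h hβ
    calc s ^ α * t ^ β ≤ s ^ α * s ^ β := by gcongr
      _ = s ^ (α + β) := (Real.rpow_add hs _ _).symm
      _ ≤ _ := le_add_of_nonneg_right (by positivity)
  · have h1 : s ^ α ≤ t ^ α := Real.rpow_le_rpow_of_nonpos ht h hα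
    calc s ^ α * t ^ β ≤ t ^ α * t ^ β := by gcongr
      _ = t ^ (α + β) := (Real.rpow_add ht _ _).symm
      _ ≤ _ := le_add_of_nonneg_left (by positivity)

/-- On a half ball the weighted kernel `G⁺(x,y)|y|^a` is dominated by `Φ(x - y) + Φ(y)` for an
integrable `Φ`. -/
lemma exists_integrable_majorant (hn : 1 ≤ n) {a C : ℝ} (ha : -(n : ℝ) < a) (hC : 0 < C) (Λ : ℝ) :
    ∃ Φ : E n → ENNReal, Measurable Φ ∧ ∫⁻ z, Φ z ≠ ⊤ ∧
      ∀ x ∈ halfSpace n ∩ ball 0 Λ, ∀ y ∈ halfSpace n ∩ ball 0 Λ, y ≠ x →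
        ENNReal.ofReal (halfSpaceKernel n C x y * ‖y‖ ^ a) ≤ Φ (x - y) + Φ y := by
  have hn' : (1 : ℝ) ≤ n := by exact_mod_cast hn
  set m : ℝ := min a 0 with hm
  have hm0 : m ≤ 0 := min_le_right _ _
  have hma : m ≤ a := min_le_left _ _
  have hmn : -(n : ℝ) < m := lt_min ha (by linarith)
  set η : ℝ := (n + m) / 4 with hη
  have hη0 : 0 < η := by linarith
  set D : ℝ := C / 2 * ((8 * Λ ^ 2) ^ η / η) * Λ ^ (a - m) with hD
  set b : ℝ := -(2 * η) + m with hb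
  set φ : E n → ℝ := fun z => D * ‖z‖ ^ b with hφ
  have hφm : Measurable φ := by fun_prop
  have hint : IntegrableOn φ (ball 0 (2 * Λ)) := by
    refine integrableOn_ball_of_norm_le_rpow (C := |D|) (α := -b) ?_ ?_ ?_
      hφm.aestronglyMeasurable
    · rw [finrank_euclideanSpace_fin]; exact hn
    · rw [finrank_euclideanSpace_fin]; linarith
    · refine Filter.Eventually.of_forall fun z => ?_
      rw [neg_neg, hφ, norm_mul, Real.norm_eq_abs, Real.norm_eq_abs, abs_of_nonneg (a := _ ^ b)
        (by positivity)]
  refine ⟨(ball 0 (2 * Λ)).indicator fun z => ENNReal.ofReal (φ z),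
    hφm.ennreal_ofReal.indicator measurableSet_ball, ?_, ?_⟩
  · rw [lintegral_indicator measurableSet_ball]
    exact hint.lintegral_lt_top.ne
  · rintro x ⟨hx, hxΛ⟩ y ⟨hy, hyΛ⟩ hxy
    rw [mem_ball_zero_iff] at hxΛ hyΛ
    have hy0 := norm_pos_of_mem_halfSpace hy
    have hΛ : 0 < Λ := hy0.trans hyΛ
    have hd : 0 < ‖x - y‖ := norm_pos_iff.2 (sub_ne_zero.2 hxy.symm)
    rw [indicator_of_mem, indicator_of_mem, ← ENNReal.ofReal_add (by positivity) (by positivity)]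
    · apply ENNReal.ofReal_le_ofReal
      have h1 : ‖y‖ ^ a ≤ Λ ^ (a - m) * ‖y‖ ^ m := by
        have : ‖y‖ ^ a = ‖y‖ ^ (a - m) * ‖y‖ ^ m := by
          rw [← Real.rpow_add hy0, sub_add_cancel]
        rw [this]
        gcongr
      calc halfSpaceKernel n C x y * ‖y‖ ^ a
          ≤ (C / 2 * ((8 * Λ ^ 2) ^ η / η) * ‖x - y‖ ^ (-(2 * η)))
            * (Λ ^ (a - m) * ‖y‖ ^ m) := by
            gcongr
            exact halfSpaceKernel_le_rpow hC hη0 hx hy hxΛ hyΛ hxy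
        _ = D * (‖x - y‖ ^ (-(2 * η)) * ‖y‖ ^ m) := by rw [hD]; ring
        _ ≤ D * (‖x - y‖ ^ b + ‖y‖ ^ b) := by
            gcongr
            exact rpow_mul_rpow_le_add hd hy0 (by linarith) hm0
        _ = _ := by rw [hφ]; ring
    · rw [mem_ball_zero_iff]; linarith
    · rw [mem_ball_zero_iff]
      exact (norm_sub_le x y).trans_lt (by linarith)

lemma ae_ne_of_one_le (hn : 1 ≤ n) (x : E n) (s : Set (E n)) :
    ∀ᵐ y ∂volume.restrict s, y ≠ x := by
  have : Nonempty (Fin n) := ⟨⟨0, hn⟩⟩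
  have : Nontrivial (E n) := inferInstance
  exact ae_restrict_of_ae (Measure.ae_ne volume x)

lemma measurable_weighted_kernel (a C : ℝ) (x : E n) :
    Measurable fun y => halfSpaceKernel n C x y * ‖y‖ ^ a := by
  have := measurable_halfSpaceKernel C x
  fun_prop

lemma integrableOn_weighted_kernel (hn : 1 ≤ n) {a C : ℝ} (ha : -(n : ℝ) < a) (hC : 0 < C)
    {Λ : ℝ} {x : E n} (hx : x ∈ halfSpace n ∩ ball 0 Λ) :
    IntegrableOn (fun y => halfSpaceKernel n C x y * ‖y‖ ^ a) (halfSpace n ∩ ball 0 Λ) := by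
  obtain ⟨Φ, hΦm, hΦ, hle⟩ := exists_integrable_majorant hn ha hC Λ
  have hms := measurableSet_halfSpace.inter (measurableSet_ball (x := (0 : E n)) (ε := Λ))
  refine (lintegral_ofReal_ne_top_iff_integrable
    (measurable_weighted_kernel a C x).aestronglyMeasurable ?_).1 ?_
  · refine (ae_restrict_iff' hms).2 (Filter.Eventually.of_forall fun y hy => ?_)
    exact mul_nonneg (halfSpaceKernel_nonneg hC.le hx.1 hy.1) (by positivity)
  · refine ne_top_of_le_ne_top (b := ∫⁻ y, (Φ (x - y) + Φ y)) ?_ ?_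
    · rw [lintegral_add_right _ hΦm, lintegral_sub_left_eq_self]
      exact ENNReal.add_ne_top.2 ⟨hΦ, hΦ⟩
    · refine le_trans (lintegral_mono_ae ?_) (setLIntegral_le_lintegral _ _)
      filter_upwards [ae_ne_of_one_le hn x _, ae_restrict_mem hms] with y hyx hy
      exact hle x hx y hy hyx

/-- Uniform absolute continuity of the weighted kernel on half balls. -/
lemma exists_setIntegral_weighted_kernel_le (hn : 1 ≤ n) {a C : ℝ} (ha : -(n : ℝ) < a)
    (hC : 0 < C) (Λ : ℝ) {ε : ℝ} (hε : 0 < ε) :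
    ∃ δ > (0 : ENNReal), ∀ A ⊆ halfSpace n ∩ ball 0 Λ, MeasurableSet A → volume A < δ →
      ∀ x ∈ halfSpace n ∩ ball 0 Λ,
        ∫ y in A, halfSpaceKernel n C x y * ‖y‖ ^ a ≤ ε := by
  obtain ⟨Φ, hΦm, hΦ, hle⟩ := exists_integrable_majorant hn ha hC Λ
  obtain ⟨δ, hδ, hδΦ⟩ := exists_pos_setLIntegral_lt_of_measure_lt hΦ
    (ε := ENNReal.ofReal (ε / 2)) (by simpa using hε)
  refine ⟨δ, hδ, fun A hA hAm hAδ x hx => ?_⟩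
  have hshift : ∫⁻ y in A, Φ (x - y) < ENNReal.ofReal (ε / 2) := by
    have hmp := Measure.measurePreserving_sub_left (volume : Measure (E n)) x
    have hA' : MeasurableSet ((fun z => x - z) ⁻¹' A) := hmp.measurable hAm
    have h1 : (fun z => x - z) ⁻¹' ((fun z => x - z) ⁻¹' A) = A := by
      ext z; simp
    have h2 := hmp.setLIntegral_comp_preimage hA' hΦm
    rw [h1] at h2
    rw [h2]
    refine hδΦ _ ?_
    rwa [hmp.measure_preimage hAm.nullMeasurableSet]
  rw [integral_eq_lintegral_of_nonneg_ae
    ((ae_restrict_iff' hAm).2 (Filter.Eventually.of_forall fun y hy =>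
      mul_nonneg (halfSpaceKernel_nonneg hC.le hx.1 (hA hy).1) (by positivity)))
    (measurable_weighted_kernel a C x).aestronglyMeasurable]
  refine ENNReal.toReal_le_of_le_ofReal hε.le ?_
  calc ∫⁻ y in A, ENNReal.ofReal (halfSpaceKernel n C x y * ‖y‖ ^ a)
      ≤ ∫⁻ y in A, (Φ (x - y) + Φ y) := by
        refine lintegral_mono_ae ?_
        filter_upwards [ae_ne_of_one_le hn x _, ae_restrict_mem hAm] with y hyx hy
        exact hle x hx y (hA hy) hyx
    _ = (∫⁻ y in A, Φ (x - y)) + ∫⁻ y in A, Φ y := lintegral_add_right _ hΦm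
    _ ≤ ENNReal.ofReal (ε / 2) + ENNReal.ofReal (ε / 2) := by
        exact add_le_add hshift.le (hδΦ A hAδ).le
    _ = ENNReal.ofReal ε := by
        rw [← ENNReal.ofReal_add (by positivity) (by positivity), add_halves]

lemma log_one_add_mul_le {c t : ℝ} (hc : 1 ≤ c) (ht : 0 ≤ t) :
    Real.log (1 + c * t) ≤ c * Real.log (1 + t) := by
  rw [← Real.log_rpow (by linarith)]
  exact Real.log_le_log (by positivity) (one_add_mul_self_le_rpow_one_add (by linarith) hc)

/-- Away from `x`, the kernel with pole `x` is controlled by the kernel with pole `x₀`. -/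
lemma exists_halfSpaceKernel_le_mul {C : ℝ} (hC : 0 < C) {x x₀ : E n} (hx : x ∈ halfSpace n)
    (hx₀ : x₀ ∈ halfSpace n) :
    ∃ c : ℝ, ∀ y ∈ halfSpace n, 1 ≤ ‖x - y‖ → y ≠ x₀ →
      halfSpaceKernel n C x y ≤ c * halfSpaceKernel n C x₀ y := by
  have hx' : 0 < lastCoord n x := hx
  have hx₀' : 0 < lastCoord n x₀ := hx₀
  set q : ℝ := 1 + ‖x₀ - x‖
  set c : ℝ := max 1 (lastCoord n x / lastCoord n x₀ * q ^ 2)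
  refine ⟨c, fun y hy hxy hy₀ => ?_⟩
  have hy' : 0 < lastCoord n y := hy
  have hd₀ : 0 < ‖x₀ - y‖ := norm_pos_iff.2 (sub_ne_zero.2 hy₀.symm)
  have hq : ‖x₀ - y‖ ≤ q * ‖x - y‖ := by
    have : ‖x₀ - y‖ ≤ ‖x₀ - x‖ + ‖x - y‖ := norm_sub_le_norm_sub_add_norm_sub _ _ _
    nlinarith [norm_nonneg (x₀ - x)]
  have ht := halfSpaceKernel_arg_nonneg hx₀ hy
  have harg : 4 * lastCoord n x * lastCoord n y / ‖x - y‖ ^ 2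
      ≤ c * (4 * lastCoord n x₀ * lastCoord n y / ‖x₀ - y‖ ^ 2) := by
    have hsq : ‖x₀ - y‖ ^ 2 ≤ q ^ 2 * ‖x - y‖ ^ 2 := by
      rw [← mul_pow]; gcongr
    calc 4 * lastCoord n x * lastCoord n y / ‖x - y‖ ^ 2
        ≤ 4 * lastCoord n x * lastCoord n y * q ^ 2 / ‖x₀ - y‖ ^ 2 := by
          rw [div_le_div_iff₀ (by positivity) (by positivity)]
          have : 0 < 4 * lastCoord n x * lastCoord n y := by positivity
          calc _ ≤ 4 * lastCoord n x * lastCoord n y * (q ^ 2 * ‖x - y‖ ^ 2) := by gcongr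
            _ = _ := by ring
      _ = lastCoord n x / lastCoord n x₀ * q ^ 2
          * (4 * lastCoord n x₀ * lastCoord n y / ‖x₀ - y‖ ^ 2) := by field_simp
      _ ≤ _ := by
          gcongr
          exact le_max_right _ _
  have h0 := halfSpaceKernel_arg_nonneg hx hy
  calc halfSpaceKernel n C x y
      ≤ C / 2 * (c * Real.log (1 + 4 * lastCoord n x₀ * lastCoord n y / ‖x₀ - y‖ ^ 2)) := by
        unfold halfSpaceKernel
        gcongr
        exact (Real.log_le_log (by linarith) (by linarith)).trans
          (log_one_add_mul_le (le_max_left _ _) ht)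
    _ = _ := by unfold halfSpaceKernel; ring

end KernelEstimates

section Solutions

variable {n : ℕ} {a p C : ℝ} {u : E n → ℝ}

/-- Nontrivial nonnegative continuous solutions of `u(x) = ∫ G⁺(x,y) |y|^a u(y)^p dy`. -/
structure IsHalfSpaceSolution (n : ℕ) (a p C : ℝ) (u : E n → ℝ) : Prop where
  one_le_dim : 1 ≤ n
  weight_gt : -(n : ℝ) < a
  one_le_exp : 1 ≤ p
  const_pos : 0 < C
  continuousOn : ContinuousOn u (closure (halfSpace n))
  nonneg : ∀ x ∈ halfSpace n, 0 ≤ u x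
  eq_integral : ∀ x ∈ halfSpace n,
    u x = ∫ y in halfSpace n, halfSpaceKernel n C x y * (‖y‖ ^ a * u y ^ p)
  nontrivial : ∃ x ∈ halfSpace n, u x ≠ 0

/-- The density `|y|^a (L/|y|)^{2n+2a} u(L²y/|y|²)^p` of the Kelvin transform of a solution. -/
def kelvinDensity (n : ℕ) (a p : ℝ) (u : E n → ℝ) (L : ℝ) (y : E n) : ℝ :=
  ‖y‖ ^ a * ((L / ‖y‖) ^ (2 * (n : ℝ) + 2 * a) * u (inversion (0 : E n) L y) ^ p)

namespace IsHalfSpaceSolution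

variable (h : IsHalfSpaceSolution n a p C u)
include h

lemma continuousOn_halfSpace : ContinuousOn u (halfSpace n) :=
  h.continuousOn.mono subset_closure

lemma exists_bound (Λ : ℝ) : ∃ M > 0, ∀ x ∈ halfSpace n ∩ ball 0 Λ, u x ≤ M := by
  have hK : IsCompact (closure (halfSpace n) ∩ closedBall 0 Λ) :=
    (isCompact_closedBall (0 : E n) Λ).inter_left isClosed_closure
  obtain ⟨M, hM⟩ := hK.bddAbove_image (h.continuousOn.mono inter_subset_left)
  refine ⟨max M 1, by positivity, fun x hx => le_max_of_le_left ?_⟩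
  exact hM ⟨x, ⟨subset_closure hx.1, ball_subset_closedBall hx.2⟩, rfl⟩

lemma density_nonneg {y : E n} (hy : y ∈ halfSpace n) : 0 ≤ ‖y‖ ^ a * u y ^ p :=
  mul_nonneg (by positivity) (Real.rpow_nonneg (h.nonneg y hy) p)

lemma aestronglyMeasurable_density :
    AEStronglyMeasurable (fun y => ‖y‖ ^ a * u y ^ p) (volume.restrict (halfSpace n)) := by
  refine ContinuousOn.aestronglyMeasurable (fun y hy => ?_) measurableSet_halfSpace
  have h1 : ContinuousAt (fun y : E n => ‖y‖ ^ a) y :=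
    continuousAt_id.norm.rpow_const (Or.inl (norm_pos_of_mem_halfSpace hy).ne')
  exact h1.continuousWithinAt.mul
    ((h.continuousOn_halfSpace y hy).rpow_const (Or.inr (by linarith [h.one_le_exp])))

lemma aestronglyMeasurable_integrand (x : E n) :
    AEStronglyMeasurable (fun y => halfSpaceKernel n C x y * (‖y‖ ^ a * u y ^ p))
      (volume.restrict (halfSpace n)) :=
  (measurable_halfSpaceKernel C x).aestronglyMeasurable.mul h.aestronglyMeasurable_density

lemma integrableOn_inter_ball {x : E n} {Λ : ℝ} (hx : x ∈ halfSpace n ∩ ball 0 Λ) :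
    IntegrableOn (fun y => halfSpaceKernel n C x y * (‖y‖ ^ a * u y ^ p))
      (halfSpace n ∩ ball 0 Λ) := by
  obtain ⟨M, hM, hle⟩ := h.exists_bound Λ
  refine Integrable.mono' ((integrableOn_weighted_kernel h.one_le_dim h.weight_gt h.const_pos
    hx).mul_const (M ^ p)) ((h.aestronglyMeasurable_integrand x).mono_set inter_subset_left) ?_
  refine (ae_restrict_iff' (measurableSet_halfSpace.inter measurableSet_ball)).2
    (Filter.Eventually.of_forall fun y hy => ?_)
  have hk := halfSpaceKernel_nonneg h.const_pos.le hx.1 hy.1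
  have hu := h.nonneg y hy.1
  rw [Real.norm_of_nonneg (mul_nonneg hk (h.density_nonneg hy.1)), mul_assoc]
  have := h.one_le_exp
  gcongr
  exact hle y hy

lemma integrableOn {x : E n} (hx : x ∈ halfSpace n) :
    IntegrableOn (fun y => halfSpaceKernel n C x y * (‖y‖ ^ a * u y ^ p)) (halfSpace n) := by
  obtain ⟨x₀, hx₀, hne⟩ := h.nontrivial
  have h₀ : IntegrableOn (fun y => halfSpaceKernel n C x₀ y * (‖y‖ ^ a * u y ^ p))
      (halfSpace n) := by
    by_contra hni
    exact hne ((h.eq_integral x₀ hx₀).trans (integral_undef hni))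
  obtain ⟨c, hc⟩ := exists_halfSpaceKernel_le_mul h.const_pos hx hx₀
  have hin := h.integrableOn_inter_ball (x := x) (Λ := ‖x‖ + 1)
    ⟨hx, mem_ball_zero_iff.2 (by linarith)⟩
  have hout : IntegrableOn (fun y => halfSpaceKernel n C x y * (‖y‖ ^ a * u y ^ p))
      (halfSpace n \ ball 0 (‖x‖ + 1)) := by
    refine Integrable.mono' ((h₀.mono_set sdiff_subset).const_mul c)
      ((h.aestronglyMeasurable_integrand x).mono_set sdiff_subset) ?_
    filter_upwards [ae_ne_of_one_le h.one_le_dim x₀ _,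
      ae_restrict_mem (measurableSet_halfSpace.diff measurableSet_ball)] with y hy₀ hy
    have hd : 1 ≤ ‖x - y‖ := by
      have h1 : ‖x‖ + 1 ≤ ‖y‖ := by simpa using hy.2
      have h2 := norm_sub_norm_le y x
      rw [norm_sub_rev] at h2
      linarith
    have hf := h.density_nonneg hy.1
    rw [Real.norm_of_nonneg (mul_nonneg (halfSpaceKernel_nonneg h.const_pos.le hx hy.1) hf),
      ← mul_assoc c]
    gcongr
    exact hc y hy.1 hd hy₀
  have := hin.union hout
  rwa [inter_union_sdiff] at this

lemma pos {x : E n} (hx : x ∈ halfSpace n) : 0 < u x := by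
  obtain ⟨x₀, hx₀, hne⟩ := h.nontrivial
  have hpos : 0 < u x₀ := (h.nonneg x₀ hx₀).lt_of_ne' hne
  have hV : IsOpen (halfSpace n ∩ u ⁻¹' Ioi 0) :=
    h.continuousOn_halfSpace.isOpen_inter_preimage isOpen_halfSpace isOpen_Ioi
  have hVpos : 0 < volume (halfSpace n ∩ u ⁻¹' Ioi 0) :=
    hV.measure_pos volume ⟨x₀, hx₀, hpos⟩
  have : Nonempty (Fin n) := ⟨⟨0, h.one_le_dim⟩⟩
  have : Nontrivial (E n) := inferInstance
  rw [h.eq_integral x hx, setIntegral_pos_iff_support_of_nonneg_ae _ (h.integrableOn hx)]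
  · refine lt_of_lt_of_le ?_ (measure_mono (s := (halfSpace n ∩ u ⁻¹' Ioi 0) \ {x}) ?_)
    · rwa [measure_sdiff_null (measure_singleton x)]
    · rintro y ⟨⟨hy, hyu⟩, hyx⟩
      have hk := halfSpaceKernel_pos h.const_pos hx hy hyx
      have hyu' : 0 < u y := hyu
      have := norm_pos_of_mem_halfSpace hy
      refine ⟨?_, hy⟩
      have : 0 < halfSpaceKernel n C x y * (‖y‖ ^ a * u y ^ p) := by positivity
      exact this.ne'
  · refine (ae_restrict_iff' measurableSet_halfSpace).2 (Filter.Eventually.of_forall fun y hy => ?_)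
    exact mul_nonneg (halfSpaceKernel_nonneg h.const_pos.le hx hy) (h.density_nonneg hy)

omit h in
lemma jacobian_mul_density {L : ℝ} (hL : 0 < L) {y : E n} (hy : y ∈ halfSpace n) :
    (L / ‖y‖) ^ (2 * n) * (‖inversion (0 : E n) L y‖ ^ a * u (inversion (0 : E n) L y) ^ p)
      = kelvinDensity n a p u L y := by
  have hy0 := norm_pos_of_mem_halfSpace hy
  have h1 : ‖inversion (0 : E n) L y‖ = ‖y‖ * (L / ‖y‖) ^ (2 : ℝ) := by
    rw [norm_inversion_zero, Real.rpow_two]; field_simp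
  rw [kelvinDensity, h1, Real.mul_rpow hy0.le (by positivity), ← Real.rpow_mul (by positivity),
    Real.rpow_add (by positivity), ← Real.rpow_natCast]
  push_cast
  ring

lemma integrableOn_inversion {x : E n} (hx : x ∈ halfSpace n) {L : ℝ} (hL : 0 < L) :
    IntegrableOn (fun y => halfSpaceKernel n C x (inversion (0 : E n) L y)
      * kelvinDensity n a p u L y) (halfSpace n ∩ ball 0 L) := by
  have h1 := (integrableOn_outside_halfBall_iff hL _).1
    ((h.integrableOn hx).mono_set (inter_subset_left (t := {y | L < ‖y‖})))
  refine h1.congr_fun (fun y hy => ?_) (measurableSet_halfSpace.inter measurableSet_ball)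
  simp only
  rw [← jacobian_mul_density hL hy.1]
  ring

lemma eq_integral_halfBall {x : E n} (hx : x ∈ halfSpace n) {L : ℝ} (hL : 0 < L) :
    u x = (∫ y in halfSpace n ∩ ball 0 L, halfSpaceKernel n C x y * (‖y‖ ^ a * u y ^ p))
      + ∫ y in halfSpace n ∩ ball 0 L, halfSpaceKernel n C x (inversion (0 : E n) L y)
        * kelvinDensity n a p u L y := by
  have : Nonempty (Fin n) := ⟨⟨0, h.one_le_dim⟩⟩
  have : Nontrivial (E n) := inferInstance
  have hms := measurableSet_halfSpace (n := n)
  have hms' : MeasurableSet {y : E n | L < ‖y‖} := measurableSet_lt measurable_const measurable_norm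
  have hae : (halfSpace n : Set (E n)) =ᵐ[volume]
      (halfSpace n ∩ ball 0 L ∪ halfSpace n ∩ {y | L < ‖y‖} : Set (E n)) := by
    have hs : ∀ᵐ y : E n, y ∉ sphere (0 : E n) L :=
      measure_eq_zero_iff_ae_notMem.1 (Measure.addHaar_sphere volume 0 L)
    filter_upwards [hs] with y hy
    rw [mem_sphere_zero_iff_norm] at hy
    refine propext ⟨fun hyH => ?_, fun hy' => hy'.elim And.left And.left⟩
    rcases lt_or_gt_of_ne hy with h1 | h1
    · exact Or.inl ⟨hyH, mem_ball_zero_iff.2 h1⟩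
    · exact Or.inr ⟨hyH, h1⟩
  rw [h.eq_integral x hx, setIntegral_congr_set hae, setIntegral_union _ (hms.inter hms')
    ((h.integrableOn hx).mono_set inter_subset_left)
    ((h.integrableOn hx).mono_set inter_subset_left), setIntegral_outside_halfBall hL]
  · congr 1
    refine setIntegral_congr_fun (hms.inter measurableSet_ball) fun y hy => ?_
    rw [← jacobian_mul_density hL hy.1]
    ring
  · refine disjoint_left.2 fun y hy hy' => ?_
    have h1 := mem_ball_zero_iff.1 hy.2
    have h2 : L < ‖y‖ := hy'.2
    linarith

lemma inversion_sub_eq_integral {x : E n} {L : ℝ} (hx : x ∈ halfSpace n) (hL : 0 < L) :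
    IntegrableOn (fun y => (halfSpaceKernel n C x y
        - halfSpaceKernel n C x (inversion (0 : E n) L y))
      * (kelvinDensity n a p u L y - ‖y‖ ^ a * u y ^ p)) (halfSpace n ∩ ball 0 L) ∧
    u (inversion (0 : E n) L x) - u x = ∫ y in halfSpace n ∩ ball 0 L,
      (halfSpaceKernel n C x y - halfSpaceKernel n C x (inversion (0 : E n) L y))
      * (kelvinDensity n a p u L y - ‖y‖ ^ a * u y ^ p) := by
  have hms := (measurableSet_halfSpace (n := n)).inter (measurableSet_ball (x := 0) (ε := L))
  have hx' := inversion_mem_halfSpace hL hx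
  have i1 := (h.integrableOn hx).mono_set (inter_subset_left (t := ball 0 L))
  have i2 := h.integrableOn_inversion hx hL
  have c3 : EqOn (fun y => halfSpaceKernel n C (inversion (0 : E n) L x) y * (‖y‖ ^ a * u y ^ p))
      (fun y => halfSpaceKernel n C x (inversion (0 : E n) L y) * (‖y‖ ^ a * u y ^ p))
      (halfSpace n ∩ ball 0 L) := fun y hy => by
    simp only [halfSpaceKernel_inversion_left C hL hx hy.1]
  have c4 : EqOn (fun y => halfSpaceKernel n C (inversion (0 : E n) L x) (inversion (0 : E n) L y)
      * kelvinDensity n a p u L y)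
      (fun y => halfSpaceKernel n C x y * kelvinDensity n a p u L y)
      (halfSpace n ∩ ball 0 L) := fun y hy => by
    simp only [halfSpaceKernel_inversion_inversion C hL hx hy.1]
  have i3 := ((h.integrableOn hx').mono_set (inter_subset_left (t := ball 0 L))).congr_fun c3 hms
  have i4 := (h.integrableOn_inversion hx' hL).congr_fun c4 hms
  have i34 : IntegrableOn (fun y => halfSpaceKernel n C x (inversion (0 : E n) L y)
      * (‖y‖ ^ a * u y ^ p) + halfSpaceKernel n C x y * kelvinDensity n a p u L y)
      (halfSpace n ∩ ball 0 L) := i3.add i4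
  have i12 : IntegrableOn (fun y => halfSpaceKernel n C x y * (‖y‖ ^ a * u y ^ p)
      + halfSpaceKernel n C x (inversion (0 : E n) L y) * kelvinDensity n a p u L y)
      (halfSpace n ∩ ball 0 L) := i1.add i2
  have e : ∀ y, (halfSpaceKernel n C x y - halfSpaceKernel n C x (inversion (0 : E n) L y))
      * (kelvinDensity n a p u L y - ‖y‖ ^ a * u y ^ p)
      = (halfSpaceKernel n C x (inversion (0 : E n) L y) * (‖y‖ ^ a * u y ^ p)
        + halfSpaceKernel n C x y * kelvinDensity n a p u L y)
        - (halfSpaceKernel n C x y * (‖y‖ ^ a * u y ^ p)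
        + halfSpaceKernel n C x (inversion (0 : E n) L y) * kelvinDensity n a p u L y) :=
    fun y => by ring
  simp only [e]
  refine ⟨i34.sub i12, ?_⟩
  rw [integral_sub i34 i12, integral_add i3 i4, integral_add i1 i2,
    ← h.eq_integral_halfBall hx hL, h.eq_integral_halfBall hx' hL,
    setIntegral_congr_fun hms c3, setIntegral_congr_fun hms c4]

lemma density_lt_kelvinDensity {L : ℝ} {y : E n} (hy : y ∈ halfSpace n)
    (hyL : ‖y‖ < L) : ‖y‖ ^ a * u (inversion (0 : E n) L y) ^ p < kelvinDensity n a p u L y := by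
  have hy0 := norm_pos_of_mem_halfSpace hy
  have hL := hy0.trans hyL
  have hu := h.pos (inversion_mem_halfSpace hL hy)
  have h1 : 1 < (L / ‖y‖) ^ (2 * (n : ℝ) + 2 * a) :=
    Real.one_lt_rpow ((one_lt_div hy0).2 hyL) (by linarith [h.weight_gt])
  unfold kelvinDensity
  gcongr
  exact lt_mul_of_one_lt_left (by positivity) h1

lemma lt_inversion_of_le {L : ℝ}
    (hle : ∀ x ∈ halfSpace n ∩ ball 0 L, u x ≤ u (inversion (0 : E n) L x)) :
    ∀ x ∈ halfSpace n ∩ ball 0 L, u x < u (inversion (0 : E n) L x) := by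
  rintro x ⟨hx, hxL⟩
  have hL : 0 < L := (norm_nonneg x).trans_lt (mem_ball_zero_iff.1 hxL)
  have hms := (measurableSet_halfSpace (n := n)).inter (measurableSet_ball (x := 0) (ε := L))
  obtain ⟨hint, heq⟩ := h.inversion_sub_eq_integral hx hL
  have hpos : ∀ y ∈ halfSpace n ∩ ball 0 L, y ≠ x →
      0 < (halfSpaceKernel n C x y - halfSpaceKernel n C x (inversion (0 : E n) L y))
        * (kelvinDensity n a p u L y - ‖y‖ ^ a * u y ^ p) := by
    intro y hy hyx
    have hyL := mem_ball_zero_iff.1 hy.2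
    refine mul_pos (sub_pos.2 (halfSpaceKernel_inversion_lt h.const_pos hx hy.1
      (mem_ball_zero_iff.1 hxL) hyL hyx)) (sub_pos.2 ?_)
    refine lt_of_le_of_lt ?_ (h.density_lt_kelvinDensity hy.1 hyL)
    have hu := h.nonneg y hy.1
    have := h.one_le_exp
    gcongr
    exact hle y hy
  have : Nonempty (Fin n) := ⟨⟨0, h.one_le_dim⟩⟩
  have : Nontrivial (E n) := inferInstance
  rw [← sub_pos, heq, setIntegral_pos_iff_support_of_nonneg_ae _ hint]
  · refine lt_of_lt_of_le ?_ (measure_mono (s := (halfSpace n ∩ ball 0 L) \ {x}) ?_)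
    · rw [measure_sdiff_null (measure_singleton x)]
      exact (isOpen_halfSpace.inter isOpen_ball).measure_pos volume ⟨x, hx, hxL⟩
    · rintro y ⟨hy, hyx⟩
      exact ⟨(hpos y hy hyx).ne', hy⟩
  · filter_upwards [ae_ne_of_one_le h.one_le_dim x _, ae_restrict_mem hms] with y hyx hy
    exact (hpos y hy hyx).le

omit h in
lemma rpow_sub_rpow_le {p s t M : ℝ} (hp : 1 ≤ p) (ht : 0 ≤ t) (hts : t < s) (hsM : s ≤ M) :
    s ^ p - t ^ p ≤ p * M ^ (p - 1) * (s - t) := by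
  have hs : 0 < s := ht.trans_lt hts
  have h1 := one_add_mul_self_le_rpow_one_add (s := t / s - 1)
    (by linarith [div_nonneg ht hs.le]) hp
  rw [add_sub_cancel, Real.div_rpow ht hs.le, le_div_iff₀ (by positivity)] at h1
  have h2 : s ^ p = s ^ (p - 1) * s := by
    rw [← Real.rpow_add_one hs.ne', sub_add_cancel]
  have h3 : s ^ p - t ^ p ≤ p * s ^ (p - 1) * (s - t) := by
    have : (1 + p * (t / s - 1)) * s ^ p = s ^ p + p * s ^ (p - 1) * (t - s) := by
      rw [h2]; field_simp
    linarith
  refine h3.trans ?_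
  have : 0 ≤ s - t := by linarith
  gcongr

lemma continuousAt_inversion {L : ℝ} (hL : 0 < L) {x : E n} (hx : x ∈ halfSpace n) :
    ContinuousAt (fun q : ℝ × E n => u (inversion (0 : E n) q.1 q.2)) (L, x) := by
  have h1 : ContinuousAt (fun q : ℝ × E n => inversion (0 : E n) q.1 q.2) (L, x) := by
    simp only [inversion_zero_eq]
    have := norm_pos_of_mem_halfSpace hx
    have : ‖((L, x) : ℝ × E n).2‖ ^ 2 ≠ 0 := by positivity
    fun_prop (disch := assumption)
  refine ContinuousAt.comp' (f := fun q : ℝ × E n => inversion (0 : E n) q.1 q.2) ?_ h1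
  exact h.continuousOn_halfSpace.continuousAt
    (isOpen_halfSpace.mem_nhds (inversion_mem_halfSpace hL hx))

lemma isOpen_setOf_inversion_lt {L : ℝ} (hL : 0 < L) :
    IsOpen {y ∈ halfSpace n ∩ ball 0 L | u (inversion (0 : E n) L y) < u y} := by
  refine isOpen_iff_mem_nhds.2 fun y hy => ?_
  have h1 : ContinuousAt (fun y => u (inversion (0 : E n) L y)) y :=
    ContinuousAt.comp' (f := fun y : E n => (L, y)) (h.continuousAt_inversion hL hy.1.1)
      (by fun_prop)
  have h2 : ContinuousAt u y :=
    h.continuousOn_halfSpace.continuousAt (isOpen_halfSpace.mem_nhds hy.1.1)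
  filter_upwards [(isOpen_halfSpace.inter isOpen_ball).mem_nhds hy.1, h1.eventually_lt h2 hy.2]
    with z hz hz' using ⟨hz, hz'⟩

/-- Maximum principle on narrow regions: the negative part of `u(L²x/|x|²) - u(x)` on the half
ball of radius `L` vanishes as soon as its support is small. -/
lemma exists_narrow_region (Λ : ℝ) :
    ∃ δ > (0 : ENNReal), ∀ L > 0, L ≤ Λ →
      volume {y ∈ halfSpace n ∩ ball 0 L | u (inversion (0 : E n) L y) < u y} < δ →
      ∀ x ∈ halfSpace n ∩ ball 0 L, u x ≤ u (inversion (0 : E n) L x) := by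
  obtain ⟨M, hM, hbd⟩ := h.exists_bound Λ
  have hp := h.one_le_exp
  have hC := h.const_pos
  set κ : ℝ := p * M ^ (p - 1)
  have hκ : 0 < κ := by positivity
  obtain ⟨δ, hδ, hsmall⟩ := exists_setIntegral_weighted_kernel_le h.one_le_dim h.weight_gt hC Λ
    (ε := 1 / (2 * κ)) (by positivity)
  refine ⟨δ, hδ, fun L hL hLΛ hvol => ?_⟩
  set B : Set (E n) := halfSpace n ∩ ball 0 L with hB
  set A : Set (E n) := {y ∈ B | u (inversion (0 : E n) L y) < u y} with hA
  have hBΛ : B ⊆ halfSpace n ∩ ball 0 Λ := inter_subset_inter_right _ (ball_subset_ball hLΛ)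
  have hAB : A ⊆ B := sep_subset _ _
  have hAm : MeasurableSet A := (h.isOpen_setOf_inversion_lt hL).measurableSet
  have hBm : MeasurableSet B := measurableSet_halfSpace.inter measurableSet_ball
  have halve : ∀ s : ℝ, 0 ≤ s → (∀ x ∈ B, u x - u (inversion (0 : E n) L x) ≤ s) →
      ∀ x ∈ B, u x - u (inversion (0 : E n) L x) ≤ s / 2 := by
    intro s hs hle x hx
    obtain ⟨hint, heq⟩ := h.inversion_sub_eq_integral hx.1 hL
    have hkA : IntegrableOn (fun y => halfSpaceKernel n C x y * ‖y‖ ^ a * (κ * s)) A :=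
      (((integrableOn_weighted_kernel h.one_le_dim h.weight_gt hC (hBΛ hx)).mono_set
        (hAB.trans hBΛ)).mul_const _)
    have hbound : ∫ y in B, -((halfSpaceKernel n C x y
          - halfSpaceKernel n C x (inversion (0 : E n) L y))
          * (kelvinDensity n a p u L y - ‖y‖ ^ a * u y ^ p))
        ≤ ∫ y in B, A.indicator (fun y => halfSpaceKernel n C x y * ‖y‖ ^ a * (κ * s)) y := by
      refine integral_mono_ae hint.neg
        ((integrable_indicator_iff hAm).2 hkA).integrableOn ?_
      filter_upwards [ae_ne_of_one_le h.one_le_dim x _, ae_restrict_mem hBm] with y hyx hy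
      have hyL := mem_ball_zero_iff.1 hy.2
      have hK := halfSpaceKernel_inversion_le hC hx.1 hy.1 (mem_ball_zero_iff.1 hx.2) hyL hyx
      have hK' := halfSpaceKernel_nonneg hC.le hx.1 (inversion_mem_halfSpace hL hy.1)
      have hk := halfSpaceKernel_nonneg hC.le hx.1 hy.1
      have hd := (h.density_lt_kelvinDensity hy.1 hyL).le
      have hui := h.nonneg _ (inversion_mem_halfSpace hL hy.1)
      have huy := h.nonneg _ hy.1
      rw [← mul_neg, neg_sub]
      by_cases hyA : y ∈ A
      · rw [indicator_of_mem hyA]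
        have h1 : ‖y‖ ^ a * u y ^ p - kelvinDensity n a p u L y ≤ ‖y‖ ^ a * (κ * s) := by
          have h2 := rpow_sub_rpow_le hp hui hyA.2 (hbd y (hBΛ hy))
          have h3 : κ * (u y - u (inversion (0 : E n) L y)) ≤ κ * s := by
            gcongr
            exact hle y hy
          calc _ ≤ ‖y‖ ^ a * (u y ^ p - u (inversion (0 : E n) L y) ^ p) := by
                rw [mul_sub]; linarith
            _ ≤ _ := by
                gcongr
                exact h2.trans h3
        calc _ ≤ (halfSpaceKernel n C x y - halfSpaceKernel n C x (inversion (0 : E n) L y))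
              * (‖y‖ ^ a * (κ * s)) := mul_le_mul_of_nonneg_left h1 (by linarith)
          _ ≤ halfSpaceKernel n C x y * (‖y‖ ^ a * (κ * s)) := by
              gcongr
              linarith
          _ = _ := by ring
      · rw [indicator_of_notMem hyA]
        refine mul_nonpos_of_nonneg_of_nonpos (by linarith) ?_
        have h1 : u y ≤ u (inversion (0 : E n) L y) := by
          by_contra hlt
          exact hyA ⟨hy, not_le.1 hlt⟩
        have h2 : ‖y‖ ^ a * u y ^ p ≤ ‖y‖ ^ a * u (inversion (0 : E n) L y) ^ p := by gcongr
        linarith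
    rw [integral_neg, ← heq, setIntegral_indicator hAm, inter_eq_self_of_subset_right hAB,
      integral_mul_const, neg_sub] at hbound
    refine hbound.trans ?_
    calc _ ≤ 1 / (2 * κ) * (κ * s) := by
          gcongr
          exact hsmall A (hAB.trans hBΛ) hAm hvol x (hBΛ hx)
      _ = s / 2 := by field_simp
  have iter : ∀ k : ℕ, ∀ x ∈ B, u x - u (inversion (0 : E n) L x) ≤ M * (1 / 2) ^ k := by
    intro k
    induction k with
    | zero =>
      intro x hx
      have := hbd x (hBΛ hx)
      have := h.nonneg _ (inversion_mem_halfSpace hL hx.1)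
      simp only [pow_zero, mul_one]
      linarith
    | succ k ih =>
      intro x hx
      refine (halve _ (by positivity) ih x hx).trans_eq ?_
      rw [pow_succ]; ring
  intro x hx
  have hlim : Tendsto (fun k : ℕ => M * (1 / 2 : ℝ) ^ k) atTop (𝓝 (M * 0)) :=
    (tendsto_pow_atTop_nhds_zero_of_lt_one (by norm_num) (by norm_num)).const_mul M
  have := ge_of_tendsto' hlim fun k => iter k x hx
  linarith

omit h in
lemma eventually_volume_ball_sdiff_lt (hn : 1 ≤ n) {L : ℝ} (hL : 0 ≤ L) {δ : ENNReal}
    (hδ : 0 < δ) : ∀ᶠ L' in 𝓝[>] L, volume (ball (0 : E n) L' \ ball 0 L) < δ := by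
  have : Nonempty (Fin n) := ⟨⟨0, hn⟩⟩
  have : Nontrivial (E n) := inferInstance
  set v : ℝ → ENNReal := fun r => ENNReal.ofReal (r ^ Module.finrank ℝ (E n))
    * volume (ball (0 : E n) 1) with hv
  have hcont : Continuous v :=
    (ENNReal.continuous_mul_const measure_ball_lt_top.ne).comp
      (ENNReal.continuous_ofReal.comp (continuous_pow _))
  have hball : ∀ r, 0 ≤ r → volume (ball (0 : E n) r) = v r := fun r hr =>
    Measure.addHaar_ball volume 0 hr
  have hfin : volume (ball (0 : E n) L) ≠ ⊤ := measure_ball_lt_top.ne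
  have hlt : v L < volume (ball (0 : E n) L) + δ := by
    rw [← hball L hL]
    exact ENNReal.lt_add_right hfin hδ.ne'
  filter_upwards [nhdsWithin_le_nhds (hcont.continuousAt.eventually_lt_const hlt),
    self_mem_nhdsWithin] with L' h1 h2
  have h2' : L < L' := h2
  refine measure_sdiff_lt_of_lt_add measurableSet_ball.nullMeasurableSet
    (ball_subset_ball h2'.le) hfin ?_
  rwa [hball L' (hL.trans h2'.le)]

lemma eventually_le_inversion_zero :
    ∀ᶠ L in 𝓝[>] (0 : ℝ), ∀ x ∈ halfSpace n ∩ ball 0 L, u x ≤ u (inversion (0 : E n) L x) := by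
  obtain ⟨δ, hδ, hnarrow⟩ := h.exists_narrow_region 1
  filter_upwards [eventually_volume_ball_sdiff_lt h.one_le_dim le_rfl hδ, self_mem_nhdsWithin,
    nhdsWithin_le_nhds (eventually_le_nhds (zero_lt_one' ℝ))] with L hv hL hL1
  refine hnarrow L hL hL1 ((measure_mono fun y hy => ?_).trans_lt hv)
  exact ⟨hy.1.2, by simp⟩

lemma eventually_le_inversion {L : ℝ} (hL : 0 < L)
    (hle : ∀ x ∈ halfSpace n ∩ ball 0 L, u x ≤ u (inversion (0 : E n) L x)) :
    ∀ᶠ L' in 𝓝[>] L, ∀ x ∈ halfSpace n ∩ ball 0 L', u x ≤ u (inversion (0 : E n) L' x) := by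
  have hlt := h.lt_inversion_of_le hle
  obtain ⟨δ, hδ, hnarrow⟩ := h.exists_narrow_region (L + 1)
  have hδ2 : 0 < δ / 2 := ENNReal.half_pos hδ.ne'
  have hBm : MeasurableSet (halfSpace n ∩ ball 0 L) :=
    measurableSet_halfSpace.inter measurableSet_ball
  have hBfin : volume (halfSpace n ∩ ball 0 L) ≠ ⊤ :=
    measure_ne_top_of_subset inter_subset_right measure_ball_lt_top.ne
  obtain ⟨K, hKB, hK, hKvol⟩ := hBm.exists_isCompact_sdiff_lt hBfin hδ2.ne'
  have hKev : ∀ᶠ L' in 𝓝 L, ∀ x ∈ K, u x < u (inversion (0 : E n) L' x) := by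
    refine hK.eventually_forall_of_forall_eventually fun x hx => ?_
    have hxH := (hKB hx).1
    have h2 : ContinuousAt (fun q : ℝ × E n => u q.2) (L, x) :=
      ContinuousAt.comp' (f := fun q : ℝ × E n => q.2)
        (h.continuousOn_halfSpace.continuousAt (isOpen_halfSpace.mem_nhds hxH)) continuousAt_snd
    exact h2.eventually_lt (h.continuousAt_inversion hL hxH) (hlt x (hKB hx))
  filter_upwards [eventually_volume_ball_sdiff_lt h.one_le_dim hL.le hδ2, self_mem_nhdsWithin,
    nhdsWithin_le_nhds (eventually_le_nhds (lt_add_one L)), nhdsWithin_le_nhds hKev]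
    with L' hv hL' hL1 hKL
  refine hnarrow L' (hL.trans hL') hL1 (lt_of_le_of_lt
    (measure_mono (t := (halfSpace n ∩ ball 0 L) \ K ∪ ball 0 L' \ ball 0 L) fun y hy => ?_)
    ((measure_union_le _ _).trans_lt ((ENNReal.add_lt_add hKvol hv).trans_eq
      (ENNReal.add_halves δ))))
  by_cases hyL : y ∈ ball 0 L
  · exact Or.inl ⟨⟨hy.1.1, hyL⟩, fun hyK => lt_asymm hy.2 (hKL y hyK)⟩
  · exact Or.inr ⟨hy.1.2, hyL⟩

lemma le_inversion {L : ℝ} (hL : 0 < L) :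
    ∀ x ∈ halfSpace n ∩ ball 0 L, u x ≤ u (inversion (0 : E n) L x) := by
  set S : Set ℝ := {L | ∀ x ∈ halfSpace n ∩ ball 0 L, u x ≤ u (inversion (0 : E n) L x)} with hS
  obtain ⟨L₀, hL₀S, hL₀, hL₀L⟩ : ∃ L₀ ∈ S, 0 < L₀ ∧ L₀ ≤ L := by
    have e1 : ∀ᶠ r in 𝓝[>] (0 : ℝ), 0 < r := self_mem_nhdsWithin
    have e2 : ∀ᶠ r in 𝓝[>] (0 : ℝ), r ≤ L := nhdsWithin_le_nhds (eventually_le_nhds hL)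
    obtain ⟨L₀, h1, h2, h3⟩ := (h.eventually_le_inversion_zero.and (e1.and e2)).exists
    exact ⟨L₀, h1, h2, h3⟩
  have hclosed : IsClosed (S ∩ Icc L₀ L) := by
    refine isClosed_of_closure_subset fun r hr => ?_
    have hrI : r ∈ Icc L₀ L := closure_minimal inter_subset_right isClosed_Icc hr
    refine ⟨fun x hx => ?_, hrI⟩
    by_contra! hlt
    have hc : ContinuousAt (fun s : ℝ => u (inversion (0 : E n) s x)) r :=
      ContinuousAt.comp' (f := fun s : ℝ => (s, x))
        (h.continuousAt_inversion (hL₀.trans_le hrI.1) hx.1) (by fun_prop)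
    obtain ⟨s, hsS, hsx, hsu⟩ := ((mem_closure_iff_frequently.1 hr).and_eventually
      ((lt_mem_nhds (mem_ball_zero_iff.1 hx.2)).and (hc.eventually_lt_const hlt))).exists
    exact hsu.not_ge (hsS.1 x ⟨hx.1, mem_ball_zero_iff.2 hsx⟩)
  exact hclosed.Icc_subset_of_forall_mem_nhdsWithin hL₀S
    (fun r hr => h.eventually_le_inversion (hL₀.trans_le hr.2.1) hr.1) ⟨hL₀L, le_rfl⟩

/-- Radial monotonicity with respect to inversion in spheres centred at the origin. -/
lemma inversion_le {L : ℝ} (hL : 0 < L) {x : E n} (hx : x ∈ halfSpace n) (hLx : L ≤ ‖x‖) :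
    u ((L ^ 2 / ‖x‖ ^ 2) • x) ≤ u x := by
  rw [← inversion_zero_eq]
  rcases hLx.eq_or_lt with heq | hlt
  · rw [inversion_of_mem_sphere (mem_sphere_zero_iff_norm.2 heq.symm)]
  · have := h.le_inversion hL _
      ⟨inversion_mem_halfSpace hL hx, mem_ball_zero_iff.2 (norm_inversion_lt hL hlt)⟩
    rwa [inversion_inversion _ hL.ne'] at this

end IsHalfSpaceSolution

end Solutions

lemma isCompact_spherical_cap (n : ℕ) (c : ℝ) :
    IsCompact {z : E n | ‖z‖ = 1 ∧ c ≤ lastCoord n z} := by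
  refine (isCompact_sphere (0 : E n) 1).of_isClosed_subset
    ((isClosed_eq continuous_norm continuous_const).inter
      (isClosed_le continuous_const continuous_lastCoord)) fun z hz => ?_
  exact mem_sphere_zero_iff_norm.2 hz.1

/-- **Radial monotonicity from the method of scaling spheres** (formulas (4.21)–(4.23) of
the paper). If `u ∈ C(cl ℝⁿ₊)` is a nonnegative, not identically zero solution of
`u(x) = ∫_{ℝⁿ₊} G⁺(x,y)|y|^a u(y)^p dy`, then `u(x) ≥ u(λ²x/|x|²)` for every `λ > 0` and
every `x ∈ ℝⁿ₊` with `|x| ≥ λ`; in particular `u(x) ≥ u(x/|x|)` for `|x| ≥ 1`, and on the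
cone `{x ∈ ℝⁿ₊ : |x| ≥ 1, xₙ ≥ |x|/√n}` the function `u` is bounded below by the positive
constant `min {u(z) : |z| = 1, zₙ ≥ 1/√n}`. -/
theorem scaling_spheres_lower_bound (n : ℕ) (hn : 1 ≤ n) (a p Cn : ℝ)
    (ha : -(n : ℝ) < a) (hp : 1 ≤ p) (hCn : 0 < Cn)
    (u : E n → ℝ)
    (hu : ContinuousOn u (closure (halfSpace n)))
    (hnonneg : ∀ x ∈ closure (halfSpace n), 0 ≤ u x)
    (hie : ∀ x ∈ halfSpace n,
      u x = ∫ y in halfSpace n, Gplus n Cn x y * ‖y‖ ^ a * u y ^ p)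
    (hnontriv : ∃ x ∈ halfSpace n, u x ≠ 0) :
    (∀ lam : ℝ, 0 < lam → ∀ x ∈ halfSpace n, lam ≤ ‖x‖ →
      u ((lam ^ 2 / ‖x‖ ^ 2) • x) ≤ u x) ∧
    (∀ x ∈ halfSpace n, 1 ≤ ‖x‖ → u ((1 / ‖x‖) • x) ≤ u x) ∧
    (0 < sInf (u '' {z : E n | ‖z‖ = 1 ∧ 1 / Real.sqrt n ≤ lastCoord n z}) ∧
      ∀ x ∈ halfSpace n, 1 ≤ ‖x‖ → ‖x‖ / Real.sqrt n ≤ lastCoord n x →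
        sInf (u '' {z : E n | ‖z‖ = 1 ∧ 1 / Real.sqrt n ≤ lastCoord n z}) ≤ u x) := by
  have hn' : 0 < n := hn
  have hsqrt : 0 < Real.sqrt n := Real.sqrt_pos.2 (by exact_mod_cast hn')
  have h : IsHalfSpaceSolution n a p Cn u :=
    { one_le_dim := hn
      weight_gt := ha
      one_le_exp := hp
      const_pos := hCn
      continuousOn := hu
      nonneg := fun x hx => hnonneg x (subset_closure hx)
      nontrivial := hnontriv
      eq_integral := fun x hx => by
        rw [hie x hx]
        refine integral_congr_ae ?_
        filter_upwards [ae_ne_of_one_le hn x _, ae_restrict_mem measurableSet_halfSpace]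
          with y hyx hy
        rw [Gplus_eq_halfSpaceKernel hn Cn hx hy hyx, mul_assoc] }
  have hunit : ∀ x ∈ halfSpace n, 1 ≤ ‖x‖ → u ((1 / ‖x‖) • x) ≤ u x := by
    intro x hx hx1
    have hx0 := norm_pos_of_mem_halfSpace hx
    have h1 := h.inversion_le (L := Real.sqrt ‖x‖) (Real.sqrt_pos.2 hx0) hx
      (Real.sqrt_le_iff.2 ⟨hx0.le, by nlinarith⟩)
    have h2 : Real.sqrt ‖x‖ ^ 2 / ‖x‖ ^ 2 = 1 / ‖x‖ := by
      rw [Real.sq_sqrt hx0.le]; field_simp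
    rwa [h2] at h1
  have hcap : {z : E n | ‖z‖ = 1 ∧ 1 / Real.sqrt n ≤ lastCoord n z} ⊆ halfSpace n :=
    fun z hz => (one_div_pos.2 hsqrt).trans_le hz.2
  have hcompact : IsCompact (u '' {z : E n | ‖z‖ = 1 ∧ 1 / Real.sqrt n ≤ lastCoord n z}) :=
    (isCompact_spherical_cap n _).image_of_continuousOn (h.continuousOn_halfSpace.mono hcap)
  have hne : (u '' {z : E n | ‖z‖ = 1 ∧ 1 / Real.sqrt n ≤ lastCoord n z}).Nonempty := by
    refine Nonempty.image u ⟨lastBasis n, by simp [lastBasis, hn'], ?_⟩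
    have h1 : lastCoord n (lastBasis n) = 1 := by simp [lastBasis, lastCoord, hn']
    rw [h1, div_le_one hsqrt, Real.one_le_sqrt]
    exact_mod_cast hn
  refine ⟨fun L hL x hx hLx => h.inversion_le hL hx hLx, hunit, ?_, fun x hx hx1 hxn => ?_⟩
  · obtain ⟨z, hz, hzu⟩ := hcompact.sInf_mem hne
    rw [← hzu]
    exact h.pos (hcap hz)
  · have hx0 := norm_pos_of_mem_halfSpace hx
    refine (csInf_le hcompact.bddBelow ⟨(1 / ‖x‖) • x, ⟨?_, ?_⟩, rfl⟩).trans (hunit x hx hx1)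
    · rw [norm_smul, Real.norm_of_nonneg (by positivity), one_div, inv_mul_cancel₀ hx0.ne']
    · rw [lastCoord_smul]
      calc 1 / Real.sqrt n = 1 / ‖x‖ * (‖x‖ / Real.sqrt n) := by field_simp
        _ ≤ _ := by gcongr
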